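/- With e : U × I → GL(n,ℝ) a smooth time-dependent parallelism, Γ^i_{jk}(x,t) = Σ_a (∂e^i_a(x,t)/∂x^j)(e(x,t)^{-1})^a_k, torsion T^i_{jk} = Γ^i_{jk} − Γ^i_{kj}, and h^i_j = ∂e^i_j/∂t, the following variation formula holds for all (x,t) ∈ U × I and all indices i,r,k: ∂T^i_{rk}(x,t)/∂t = (e(x,t)^{-1})^a_k ( ∂h^i_a/∂x^r − Γ^i_{rb} h^b_a ) − (e(x,t)^{-1})^a_r ( ∂h^i_a/∂x^k − Γ^i_{kb} h^b_a ). -/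

import Mathlib

noncomputable section

open Set

/-- The `j`-th coordinate partial derivative of a real-valued function on `ℝⁿ`. -/
noncomputable def pd {n : ℕ} (j : Fin n) (f : (Fin n → ℝ) → ℝ) (x : Fin n → ℝ) : ℝ :=
  fderiv ℝ f x (Pi.single j 1)

/-- The time-dependent connection coefficients
`Γ^i_{jk}(x,t) = Σ_a (∂e^i_a(x,t)/∂x^j) (e(x,t)⁻¹)^a_k` of a time-dependent
parallelism `e`. -/
noncomputable def tGam {n : ℕ} (e : (Fin n → ℝ) → ℝ → Matrix (Fin n) (Fin n) ℝ)
    (i j k : Fin n) (x : Fin n → ℝ) (t : ℝ) : ℝ :=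
  ∑ a, pd j (fun x' => e x' t i a) x * (e x t)⁻¹ a k

/-- The variation `h^i_j(x,t) = ∂e^i_j(x,t)/∂t`. -/
noncomputable def tVar {n : ℕ} (e : (Fin n → ℝ) → ℝ → Matrix (Fin n) (Fin n) ℝ)
    (i j : Fin n) (x : Fin n → ℝ) (t : ℝ) : ℝ :=
  deriv (fun t' => e x t' i j) t

/-- Time differentiation of a spatial partial derivative: mixed partial derivatives commute. -/
theorem hasDerivAt_pd {n : ℕ} (f : (Fin n → ℝ) × ℝ → ℝ) (x : Fin n → ℝ) (t : ℝ)
    (hf : ContDiffAt ℝ 2 f (x, t)) (j : Fin n) :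
    HasDerivAt (fun t' => pd j (fun x' => f (x', t')) x)
      (pd j (fun x' => deriv (fun t' => f (x', t')) t) x) t := by
  have hev : ∀ᶠ q in nhds (x, t), DifferentiableAt ℝ f q :=
    (hf.eventually (by simp)).mono fun q hq => hq.differentiableAt (by simp)
  have hd : HasFDerivAt (fderiv ℝ f) (fderiv ℝ (fderiv ℝ f) (x, t)) (x, t) :=
    ((hf.fderiv_right (m := 1) (by norm_num)).differentiableAt (by simp)).hasFDerivAt
  have hspace (y : Fin n → ℝ) (s : ℝ) :
      HasFDerivAt (fun y' : Fin n → ℝ => (y', s)) (ContinuousLinearMap.inl ℝ (Fin n → ℝ) ℝ) y :=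
    hasFDerivAt_prodMk_left y s
  have htime (y : Fin n → ℝ) (s : ℝ) : HasDerivAt (fun s' : ℝ => (y, s')) (0, 1) s :=
    (hasDerivAt_const s y).prodMk (hasDerivAt_id s)
  have hpd : (fun t' => pd j (fun x' => f (x', t')) x) =ᶠ[nhds t]
      fun t' => fderiv ℝ f (x, t') (Pi.single j 1, 0) := by
    filter_upwards [(htime x t).continuousAt.eventually hev] with s hs
    have h := hs.hasFDerivAt.comp x (hspace x s)
    have h' : fderiv ℝ (fun x' => f (x', s)) x = _ := h.fderiv
    simp [pd, h']
  have hderiv : (fun x' => deriv (fun t' => f (x', t')) t) =ᶠ[nhds x]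
      fun x' => fderiv ℝ f (x', t) (0, 1) := by
    filter_upwards [(hspace x t).continuousAt.eventually hev] with y hy
    exact (hy.hasFDerivAt.comp_hasDerivAt t (htime y t)).deriv
  have h1 : HasDerivAt (fun t' => fderiv ℝ f (x, t') (Pi.single j 1, 0))
      (fderiv ℝ (fderiv ℝ f) (x, t) (0, 1) (Pi.single j 1, 0)) t := by
    simpa using (hd.comp_hasDerivAt t (htime x t)).clm_apply
      (hasDerivAt_const t ((Pi.single j 1, 0) : (Fin n → ℝ) × ℝ))
  have h2 : HasFDerivAt (fun x' => fderiv ℝ f (x', t) (0, 1)) _ x :=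
    (hd.comp x (hspace x t)).clm_apply (hasFDerivAt_const ((0, 1) : (Fin n → ℝ) × ℝ) x)
  have hsymm := hf.isSymmSndFDerivAt (by simp)
  have hval : pd j (fun x' => deriv (fun t' => f (x', t')) t) x =
      fderiv ℝ (fderiv ℝ f) (x, t) (0, 1) (Pi.single j 1, 0) := by
    rw [pd, hderiv.fderiv_eq, h2.fderiv, hsymm.eq (0, 1) (Pi.single j 1, 0)]
    simp
  rw [hval]
  exact h1.congr_of_eventuallyEq hpd

/-- Entrywise derivative of the inverse of an invertible matrix. -/
theorem hasDerivAt_matrix_inv_apply {n : ℕ} {A : ℝ → Matrix (Fin n) (Fin n) ℝ}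
    {A' : Matrix (Fin n) (Fin n) ℝ} {t : ℝ}
    (hA : ∀ i j, HasDerivAt (fun s => A s i j) (A' i j) t) (hu : IsUnit (A t)) (i j : Fin n) :
    HasDerivAt (fun s => (A s)⁻¹ i j) (-((A t)⁻¹ * A' * (A t)⁻¹) i j) t := by
  let _ : NormedRing (Matrix (Fin n) (Fin n) ℝ) := Matrix.linftyOpNormedRing
  let _ : NormedAlgebra ℝ (Matrix (Fin n) (Fin n) ℝ) := Matrix.linftyOpNormedAlgebra
  have _ : CompleteSpace (Matrix (Fin n) (Fin n) ℝ) := FiniteDimensional.complete ℝ _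
  have hmat : HasDerivAt A A' t := by
    have h : HasDerivAt (fun s => ∑ a, ∑ b, A s a b • Matrix.single a b (1 : ℝ))
        (∑ a, ∑ b, A' a b • Matrix.single a b (1 : ℝ)) t :=
      HasDerivAt.fun_sum fun a _ => HasDerivAt.fun_sum fun b _ => (hA a b).smul_const _
    simpa [Matrix.smul_single, ← Matrix.matrix_eq_sum_single] using h
  obtain ⟨u, hu⟩ := hu
  have hinv := hasFDerivAt_ringInverse (𝕜 := ℝ) u
  rw [hu] at hinv
  have h := (LinearMap.toContinuousLinearMap
    (Matrix.entryLinearMap ℝ ℝ i j)).hasFDerivAt.comp_hasDerivAt t (hinv.comp_hasDerivAt t hmat)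
  have huinv : (↑u⁻¹ : Matrix (Fin n) (Fin n) ℝ) = (A t)⁻¹ := by
    rw [← hu, Matrix.coe_units_inv]
  simp only [Function.comp_def, ← Matrix.nonsing_inv_eq_ringInverse, huinv] at h
  simpa using! h

/-- The time derivative of the connection coefficients of a parallelism. -/
theorem hasDerivAt_tGam {n : ℕ} {e : (Fin n → ℝ) → ℝ → Matrix (Fin n) (Fin n) ℝ}
    {x : Fin n → ℝ} {t : ℝ}
    (he : ∀ i j, ContDiffAt ℝ 2 (fun q : (Fin n → ℝ) × ℝ => e q.1 q.2 i j) (x, t))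
    (hu : IsUnit (e x t)) (i j k : Fin n) :
    HasDerivAt (fun s => tGam e i j k x s)
      (∑ a, (e x t)⁻¹ a k *
        (pd j (fun x' => tVar e i a x' t) x - ∑ b, tGam e i j b x t * tVar e b a x t)) t := by
  have hvar (a b : Fin n) :
      HasDerivAt (fun s => e x s a b) (Matrix.of (fun a b => tVar e a b x t) a b) t := by
    have hd := (he a b).differentiableAt (by simp)
    have hc : DifferentiableAt ℝ (fun s : ℝ => (x, s)) t := by fun_prop
    exact (DifferentiableAt.comp t hd hc).hasDerivAt
  have h := HasDerivAt.fun_sum (u := Finset.univ) fun (a : Fin n) _ =>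
    (hasDerivAt_pd _ x t (he i a) j).fun_mul (hasDerivAt_matrix_inv_apply hvar hu a k)
  refine h.congr_deriv ?_
  have hcorr : ∑ a, (e x t)⁻¹ a k * ∑ b, tGam e i j b x t * tVar e b a x t =
      ∑ a, pd j (fun x' => e x' t i a) x *
        ((e x t)⁻¹ * Matrix.of (fun a b => tVar e a b x t) * (e x t)⁻¹) a k := by
    simp only [Matrix.mul_apply, Matrix.of_apply, tGam, Finset.mul_sum, Finset.sum_mul]
    rw [Finset.sum_comm_cycle]
    refine Finset.sum_congr rfl fun c _ => Finset.sum_congr rfl fun a _ =>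
      Finset.sum_congr rfl fun b _ => ?_
    ring
  simp only [mul_sub, Finset.sum_sub_distrib, hcorr, mul_neg, ← sub_eq_add_neg]
  congr 1
  exact Finset.sum_congr rfl fun a _ => mul_comm _ _

/-- The variation of the torsion `T^i_{jk} = Γ^i_{jk} − Γ^i_{kj}` under a
time-dependent parallelism:
`∂T^i_{rk}/∂t = (e⁻¹)^a_k (∂h^i_a/∂x^r − Γ^i_{rb} h^b_a) − (e⁻¹)^a_r (∂h^i_a/∂x^k − Γ^i_{kb} h^b_a)`. -/
theorem stmt_17 {n : ℕ} (hn : 2 ≤ n) (U : Set (Fin n → ℝ)) (hU : IsOpen U)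
    (I : Set ℝ) (hI : IsOpen I) (hIint : I.OrdConnected)
    (e : (Fin n → ℝ) → ℝ → Matrix (Fin n) (Fin n) ℝ)
    (hsmooth : ∀ i j : Fin n, ContDiffOn ℝ (⊤ : ℕ∞)
      (fun q : (Fin n → ℝ) × ℝ => e q.1 q.2 i j) (U ×ˢ I))
    (hinv : ∀ x ∈ U, ∀ t ∈ I, IsUnit (e x t)) :
    ∀ x ∈ U, ∀ t ∈ I, ∀ i r k : Fin n,
      deriv (fun t' => tGam e i r k x t' - tGam e i k r x t') t =
        ∑ a, (e x t)⁻¹ a k *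
            (pd r (fun x' => tVar e i a x' t) x - ∑ b, tGam e i r b x t * tVar e b a x t)
          - ∑ a, (e x t)⁻¹ a r *
            (pd k (fun x' => tVar e i a x' t) x - ∑ b, tGam e i k b x t * tVar e b a x t) := by
  intro x hx t ht i r k
  have he (a b : Fin n) : ContDiffAt ℝ 2 (fun q : (Fin n → ℝ) × ℝ => e q.1 q.2 a b) (x, t) :=
    ((hsmooth a b).contDiffAt ((hU.prod hI).mem_nhds ⟨hx, ht⟩)).of_le
      (WithTop.coe_le_coe.2 (le_top (a := (2 : ℕ∞))))
  have hu := hinv x hx t ht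
  exact ((hasDerivAt_tGam he hu i r k).sub (hasDerivAt_tGam he hu i k r)).deriv
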